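/- Let D ≥ 1 and n ≥ 1 be integers, and for each j = 1,…,D let α_j < β_j be reals with scaled Chebyshev nodes η^{(j)}_k = ((α_j−β_j)/2)·ζ_k + (α_j+β_j)/2 and basis polynomials φ^{[α_j,β_j]}. Then for every tensor T : {1,…,n}^D → ℝ and every point ξ = (ξ_1,…,ξ_D) with ξ_j ∈ [α_j, β_j] for each j, | Σ_{i_1=1}^{n} ⋯ Σ_{i_D=1}^{n} T(i_1,…,i_D) · ∏_{j=1}^{D} φ^{[α_j,β_j]}(η^{(j)}_{i_j}, ξ_j) | ≤ ((2/π)·log(n) + 1)^D · ( max over all multi-indices i of |T(i)| ). -/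

import Mathlib

open Real Finset

/-- Chebyshev polynomial of the first kind of degree `m`, evaluated at `x`. -/
noncomputable def chebT (m : ℕ) (x : ℝ) : ℝ :=
  (Polynomial.Chebyshev.T ℝ m).eval x

/-- The Chebyshev nodes of the first kind in `[-1,1]` (indexed by `Fin n`, so that
index `k` corresponds to the node `cos((2(k+1)−1)π/(2n)) = cos((2k+1)π/(2n))`). -/
noncomputable def chebNode (n : ℕ) (k : Fin n) : ℝ :=
  Real.cos ((2 * (k : ℝ) + 1) * Real.pi / (2 * (n : ℝ)))

/-- The Chebyshev basis polynomial on `[α, β]`: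
`φ^{[α,β]}(η_i, x) = 1/n + (2/n)·Σ_{m=1}^{n−1} T_m(ζ_i)·T_m((2x − (α+β))/(α−β))`. -/
noncomputable def chebBasis (n : ℕ) (α β : ℝ) (i : Fin n) (x : ℝ) : ℝ :=
  1 / (n : ℝ) + (2 / (n : ℝ)) *
    ∑ m ∈ Finset.Icc 1 (n - 1),
      chebT m (chebNode n i) * chebT m ((2 * x - (α + β)) / (α - β))

/-- The modified Dirichlet kernel
`(1 + 2 cos s + ⋯ + 2 cos ((n - 1) s) + cos (n s)) / n`. -/
noncomputable def chebKernel (n : ℕ) (s : ℝ) : ℝ :=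
  1 / (n : ℝ) + (2 / (n : ℝ)) * ∑ m ∈ Finset.Icc 1 (n - 1), Real.cos (m * s)
    + (1 / (n : ℝ)) * Real.cos (n * s)

/-- The angle of the `k`-th Chebyshev node. -/
noncomputable def chebAngle (n k : ℕ) : ℝ :=
  (2 * (k : ℝ) + 1) * Real.pi / (2 * (n : ℝ))

/-- Sum of the absolute values of the kernel over `2 * n` equispaced translates. -/
noncomputable def chebKernelSum (n : ℕ) (θ : ℝ) : ℝ :=
  ∑ k ∈ Finset.range (2 * n), |chebKernel n (θ - chebAngle n k)|

lemma dirichlet_sum_mul_sin (N : ℕ) (s : ℝ) :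
    (1 + 2 * ∑ m ∈ Finset.Icc 1 N, Real.cos (m * s)) * Real.sin (s / 2) =
      Real.sin (N * s + s / 2) := by
  induction N with
  | zero => simp
  | succ N ih =>
    rw [Finset.sum_Icc_succ_top (by omega)]
    have h1 : Real.sin (N * s + s / 2) = Real.sin (((N + 1 : ℕ) : ℝ) * s - s / 2) := by
      congr 1; push_cast; ring
    rw [h1, Real.sin_sub] at ih
    rw [Real.sin_add]
    linarith

lemma chebKernel_mul_sin {n : ℕ} (hn : 1 ≤ n) (s : ℝ) :
    n * chebKernel n s * Real.sin (s / 2) = Real.sin (n * s) * Real.cos (s / 2) := by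
  obtain ⟨N, rfl⟩ := Nat.exists_eq_add_of_le' hn
  have h := dirichlet_sum_mul_sin N s
  have h1 : Real.sin (N * s + s / 2) = Real.sin (((N + 1 : ℕ) : ℝ) * s - s / 2) := by
    congr 1; push_cast; ring
  rw [h1, Real.sin_sub] at h
  have hN : ((N + 1 : ℕ) : ℝ) ≠ 0 := by positivity
  have h2 : ((N + 1 : ℕ) : ℝ) * chebKernel (N + 1) s =
      1 + 2 * ∑ m ∈ Finset.Icc 1 N, Real.cos (m * s) + Real.cos (((N + 1 : ℕ) : ℝ) * s) := by
    unfold chebKernel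
    rw [Nat.add_sub_cancel, mul_add, mul_add, ← mul_assoc, ← mul_assoc, mul_div_cancel₀ _ hN,
      mul_div_cancel₀ _ hN, one_mul]
  rw [h2, add_mul]
  linarith

lemma chebKernel_neg (n : ℕ) (s : ℝ) : chebKernel n (-s) = chebKernel n s := by
  simp [chebKernel]

lemma chebKernel_periodic (n : ℕ) : Function.Periodic (chebKernel n) (2 * Real.pi) := by
  intro s
  simp only [chebKernel, mul_add, Real.cos_add_nat_mul_two_pi]

lemma chebKernel_continuous (n : ℕ) : Continuous (chebKernel n) := by
  unfold chebKernel
  fun_prop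

lemma cos_nat_mul_chebAngle {n : ℕ} (hn : 1 ≤ n) (k : ℕ) :
    Real.cos (n * chebAngle n k) = 0 := by
  have hn' : (n : ℝ) ≠ 0 := by positivity
  rw [Real.cos_eq_zero_iff]
  refine ⟨k, ?_⟩
  unfold chebAngle
  push_cast
  field_simp

lemma two_pi_sub_chebAngle {n k : ℕ} (hk : k < n) :
    chebAngle n (2 * n - 1 - k) = 2 * Real.pi - chebAngle n k := by
  have hn' : (n : ℝ) ≠ 0 := by
    have : 0 < n := by omega
    positivity
  unfold chebAngle
  rw [show 2 * n - 1 - k = 2 * n - (k + 1) by omega, Nat.cast_sub (by omega)]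
  push_cast
  field_simp
  ring

lemma chebBasis_eq_chebKernel {n : ℕ} (hn : 1 ≤ n) {α β x θ : ℝ} (i : Fin n)
    (hθ : (2 * x - (α + β)) / (α - β) = Real.cos θ) :
    chebBasis n α β i x =
      (chebKernel n (θ - chebAngle n i) + chebKernel n (θ + chebAngle n i)) / 2 := by
  have hnode : chebNode n i = Real.cos (chebAngle n i) := rfl
  have hend : Real.cos (n * (θ - chebAngle n i)) + Real.cos (n * (θ + chebAngle n i)) = 0 := by
    rw [mul_sub, mul_add, Real.cos_sub, Real.cos_add, cos_nat_mul_chebAngle hn]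
    ring
  have hsum : ∑ m ∈ Finset.Icc 1 (n - 1), chebT m (chebNode n i) * chebT m (Real.cos θ) =
      (∑ m ∈ Finset.Icc 1 (n - 1), Real.cos (m * (θ - chebAngle n i)) +
        ∑ m ∈ Finset.Icc 1 (n - 1), Real.cos (m * (θ + chebAngle n i))) / 2 := by
    rw [← Finset.sum_add_distrib, Finset.sum_div]
    refine Finset.sum_congr rfl fun m _ => ?_
    have hT (u : ℝ) : chebT m (Real.cos u) = Real.cos (m * u) := by
      unfold chebT
      exact_mod_cast Polynomial.Chebyshev.T_real_cos u m
    rw [hnode, hT, hT, mul_sub, mul_add, Real.cos_sub, Real.cos_add]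
    ring
  unfold chebBasis chebKernel
  rw [hθ, hsum]
  linear_combination (-(1 / (2 * (n : ℝ)))) * hend

lemma chebKernelSum_eq_sum_pairs (n : ℕ) (θ : ℝ) :
    chebKernelSum n θ = ∑ k ∈ Finset.range n,
      (|chebKernel n (θ - chebAngle n k)| + |chebKernel n (θ + chebAngle n k)|) := by
  unfold chebKernelSum
  rw [two_mul, Finset.sum_range_add, Finset.sum_add_distrib]
  congr 1
  rw [← Finset.sum_range_reflect]
  refine Finset.sum_congr rfl fun k hk => ?_
  have hk' : k < n := Finset.mem_range.mp hk
  rw [show n + (n - 1 - k) = 2 * n - 1 - k by omega, two_pi_sub_chebAngle hk',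
    ← chebKernel_periodic n (θ - (2 * Real.pi - chebAngle n k))]
  congr 2
  ring

lemma sum_abs_chebBasis_le_chebKernelSum {n : ℕ} (hn : 1 ≤ n) {α β x θ : ℝ}
    (hθ : (2 * x - (α + β)) / (α - β) = Real.cos θ) :
    ∑ i : Fin n, |chebBasis n α β i x| ≤ chebKernelSum n θ / 2 := by
  rw [chebKernelSum_eq_sum_pairs, Finset.sum_div,
    ← Fin.sum_univ_eq_sum_range (fun k =>
      (|chebKernel n (θ - chebAngle n k)| + |chebKernel n (θ + chebAngle n k)|) / 2)]
  refine Finset.sum_le_sum fun i _ => ?_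
  rw [chebBasis_eq_chebKernel hn i hθ, abs_div, abs_two]
  gcongr
  exact abs_add_le _ _

lemma chebKernelSum_periodic {n : ℕ} (hn : 1 ≤ n) :
    Function.Periodic (chebKernelSum n) (Real.pi / n) := by
  have hn' : (n : ℝ) ≠ 0 := by positivity
  intro θ
  obtain ⟨N, hN⟩ : ∃ N, 2 * n = N + 1 := ⟨2 * n - 1, by omega⟩
  unfold chebKernelSum
  rw [hN, Finset.sum_range_succ', Finset.sum_range_succ]
  congr 1
  · refine Finset.sum_congr rfl fun k _ => ?_
    congr 2
    unfold chebAngle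
    push_cast
    field_simp
    ring
  · rw [← chebKernel_periodic n (θ - chebAngle n N)]
    congr 2
    have hN' : (N : ℝ) = 2 * n - 1 := by
      have : ((2 * n : ℕ) : ℝ) = (N + 1 : ℕ) := by rw [hN]
      push_cast at this
      linarith
    unfold chebAngle
    rw [hN']
    push_cast
    field_simp
    ring

/-- `sin (n x) / sin x` is antitone on `[0, π / (2 n)]`. -/
lemma sin_mul_sin_nat_mul_le {n : ℕ} {a b : ℝ} (ha : 0 ≤ a) (hab : a ≤ b)
    (hb : n * b ≤ Real.pi / 2) :
    Real.sin a * Real.sin (n * b) ≤ Real.sin b * Real.sin (n * a) := by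
  induction n with
  | zero => simp
  | succ n ih =>
    have hpi := Real.pi_pos
    push_cast at hb ⊢
    have hb0 : 0 ≤ b := ha.trans hab
    have hn0 : (0 : ℝ) ≤ n := n.cast_nonneg
    have hnb : 0 ≤ n * b := by positivity
    have hna : 0 ≤ n * a := by positivity
    have hnab : n * a ≤ n * b := by gcongr
    have ih' := ih (by linarith)
    have hca : 0 ≤ Real.cos a := Real.cos_nonneg_of_mem_Icc ⟨by linarith, by linarith⟩
    have hsa : 0 ≤ Real.sin a := Real.sin_nonneg_of_nonneg_of_le_pi ha (by linarith)
    have hsb : 0 ≤ Real.sin b := Real.sin_nonneg_of_nonneg_of_le_pi hb0 (by linarith)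
    have hsnb : 0 ≤ Real.sin (n * b) := Real.sin_nonneg_of_nonneg_of_le_pi hnb (by linarith)
    have hc : Real.cos b ≤ Real.cos a := Real.cos_le_cos_of_nonneg_of_le_pi ha (by linarith) hab
    have hcn : Real.cos (n * b) ≤ Real.cos (n * a) :=
      Real.cos_le_cos_of_nonneg_of_le_pi hna (by linarith) hnab
    rw [add_mul, add_mul, one_mul, one_mul, Real.sin_add, Real.sin_add]
    have h1 := mul_le_mul_of_nonneg_right ih' hca
    have h2 := mul_le_mul_of_nonneg_left hc (mul_nonneg hsa hsnb)
    have h3 := mul_le_mul_of_nonneg_left hcn (mul_nonneg hsa hsb)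
    linarith

lemma cos_nat_mul_mul_le {n : ℕ} (hn : 1 ≤ n) {θ t : ℝ} (hθ : |θ| ≤ Real.pi / (2 * n))
    (ht : Real.pi / (2 * n) ≤ t) (htpi : t ≤ Real.pi) :
    Real.cos (n * θ) * (1 - Real.cos t) ≤ Real.cos θ - Real.cos t := by
  have hn' : (0 : ℝ) < n := by positivity
  have hpi := Real.pi_pos
  set t₀ := Real.pi / (2 * n) with ht₀
  have ht₀pos : 0 < t₀ := by positivity
  have hnt : (n : ℝ) * (t₀ / 2) = Real.pi / 4 := by
    rw [ht₀]; field_simp; ring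
  have key := sin_mul_sin_nat_mul_le (n := n) (a := |θ| / 2) (b := t₀ / 2) (by positivity)
    (by linarith) (by linarith)
  rw [hnt] at key
  have hs0 : 0 ≤ Real.sin (|θ| / 2) :=
    Real.sin_nonneg_of_nonneg_of_le_pi (by positivity) (by linarith)
  have hs1 : 0 ≤ Real.sin (Real.pi / 4) :=
    Real.sin_nonneg_of_nonneg_of_le_pi (by positivity) (by linarith)
  have hsq := pow_le_pow_left₀ (mul_nonneg hs0 hs1) key 2
  have half (u : ℝ) : Real.sin u ^ 2 = (1 - Real.cos (2 * u)) / 2 := by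
    rw [Real.sin_sq_eq_half_sub]; ring
  rw [mul_pow, mul_pow, half, half, half, half] at hsq
  rw [show 2 * (|θ| / 2) = |θ| by ring, show 2 * (Real.pi / 4) = Real.pi / 2 by ring,
    show 2 * (t₀ / 2) = t₀ by ring, show 2 * (n * (|θ| / 2)) = |n * θ| by
      rw [abs_mul, abs_of_pos hn']; ring, Real.cos_abs, Real.cos_abs, Real.cos_pi_div_two] at hsq
  have hct : Real.cos t ≤ Real.cos t₀ :=
    Real.cos_le_cos_of_nonneg_of_le_pi ht₀pos.le htpi ht
  have h1 : 0 ≤ 1 - Real.cos (n * θ) := by linarith [Real.cos_le_one (n * θ)]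
  nlinarith [mul_le_mul_of_nonneg_right hct h1]

lemma abs_sin_nat_mul_sub_chebAngle {n : ℕ} (hn : 1 ≤ n) (k : ℕ) (θ : ℝ) :
    |Real.sin (n * (θ - chebAngle n k))| = |Real.cos (n * θ)| := by
  have hc := cos_nat_mul_chebAngle hn k
  have hs : |Real.sin (n * chebAngle n k)| = 1 := by
    rw [Real.abs_sin_eq_sqrt_one_sub_cos_sq, hc]; simp
  rw [mul_sub, Real.sin_sub, hc, mul_zero, zero_sub, abs_neg, abs_mul, hs, mul_one]

lemma abs_chebKernel_sub_chebAngle {n : ℕ} (hn : 1 ≤ n) {k : ℕ} {θ : ℝ}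
    (h0 : 0 < chebAngle n k - θ) (hpi : chebAngle n k - θ ≤ Real.pi) :
    n * |chebKernel n (θ - chebAngle n k)| = |Real.cos (n * θ)| *
      (Real.cos ((chebAngle n k - θ) / 2) / Real.sin ((chebAngle n k - θ) / 2)) := by
  set u := chebAngle n k - θ with hu
  have hs : 0 < Real.sin (u / 2) := Real.sin_pos_of_pos_of_lt_pi (by linarith) (by linarith)
  have hc : 0 ≤ Real.cos (u / 2) := Real.cos_nonneg_of_mem_Icc ⟨by linarith, by linarith⟩
  have h := congrArg abs (chebKernel_mul_sin hn (θ - chebAngle n k))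
  rw [abs_mul, abs_mul, abs_mul, abs_sin_nat_mul_sub_chebAngle hn,
    show (θ - chebAngle n k) / 2 = -(u / 2) by rw [hu]; ring, Real.sin_neg, Real.cos_neg, abs_neg,
    abs_of_pos hs, abs_of_nonneg hc, Nat.abs_cast] at h
  rw [← mul_div_assoc, eq_div_iff hs.ne']
  exact h

lemma chebKernel_pair_le {n k : ℕ} (hk : k < n) {θ : ℝ} (hθ : |θ| < Real.pi / (2 * n)) :
    |chebKernel n (θ - chebAngle n k)| + |chebKernel n (θ + chebAngle n k)| ≤
      2 / n * Real.cot (chebAngle n k / 2) := by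
  have hn : 1 ≤ n := by omega
  have hn' : (0 : ℝ) < n := by positivity
  have hpi := Real.pi_pos
  have hlo : Real.pi / (2 * n) ≤ chebAngle n k := by
    unfold chebAngle
    gcongr
    nlinarith [(k.cast_nonneg : (0 : ℝ) ≤ k)]
  have hhi : chebAngle n k + Real.pi / (2 * n) ≤ Real.pi := by
    have hk' : (k : ℝ) + 1 ≤ n := by exact_mod_cast hk
    unfold chebAngle
    rw [← add_div, div_le_iff₀ (by positivity)]
    nlinarith
  obtain ⟨hθ1, hθ2⟩ := abs_lt.mp hθ
  have hcosn : 0 ≤ Real.cos (n * θ) := by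
    have hb : |n * θ| ≤ Real.pi / 2 := by
      rw [abs_mul, Nat.abs_cast]
      calc (n : ℝ) * |θ| ≤ n * (Real.pi / (2 * n)) := by gcongr
        _ = Real.pi / 2 := by field_simp
    exact Real.cos_nonneg_of_mem_Icc ⟨by linarith [(abs_le.mp hb).1], (abs_le.mp hb).2⟩
  have e1 := abs_chebKernel_sub_chebAngle hn (k := k) (θ := θ) (by linarith) (by linarith)
  have e2 := abs_chebKernel_sub_chebAngle hn (k := k) (θ := -θ) (by linarith) (by linarith)
  have key := cos_nat_mul_mul_le hn hθ.le hlo (by linarith [show 0 < Real.pi / (2 * n) by positivity])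
  rw [mul_neg, Real.cos_neg, show -θ - chebAngle n k = -(θ + chebAngle n k) by ring,
    chebKernel_neg, sub_neg_eq_add] at e2
  rw [abs_of_nonneg hcosn] at e1 e2
  set t := chebAngle n k with ht
  have ht0 : 0 < t := lt_of_lt_of_le (by positivity) hlo
  have hs : 0 < Real.sin (t / 2) := Real.sin_pos_of_pos_of_lt_pi (by linarith) (by linarith)
  have hct : 0 ≤ Real.cos (t / 2) := Real.cos_nonneg_of_mem_Icc ⟨by linarith, by linarith⟩
  have ha : 0 < Real.sin ((t - θ) / 2) := Real.sin_pos_of_pos_of_lt_pi (by linarith) (by linarith)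
  have hb : 0 < Real.sin ((t + θ) / 2) := Real.sin_pos_of_pos_of_lt_pi (by linarith) (by linarith)
  have hprod : 2 * (Real.sin ((t - θ) / 2) * Real.sin ((t + θ) / 2)) =
      Real.cos θ - Real.cos t := by
    have h1 : Real.cos θ = Real.cos ((t + θ) / 2 - (t - θ) / 2) := by congr 1; ring
    have h2 : Real.cos t = Real.cos ((t + θ) / 2 + (t - θ) / 2) := by congr 1; ring
    rw [h1, h2, Real.cos_sub, Real.cos_add]; ring
  have hsum : Real.cos ((t - θ) / 2) * Real.sin ((t + θ) / 2) +
      Real.sin ((t - θ) / 2) * Real.cos ((t + θ) / 2) =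
      2 * Real.sin (t / 2) * Real.cos (t / 2) := by
    rw [← Real.sin_two_mul, show 2 * (t / 2) = (t - θ) / 2 + (t + θ) / 2 by ring, Real.sin_add]
    ring
  have hcos : 1 - Real.cos t = 2 * Real.sin (t / 2) ^ 2 := by
    rw [Real.sin_sq_eq_half_sub, show 2 * (t / 2) = t by ring]; ring
  rw [hcos, ← hprod] at key
  have hfinal : n * (|chebKernel n (θ - t)| + |chebKernel n (θ + t)|) ≤
      2 * (Real.cos (t / 2) / Real.sin (t / 2)) := by
    rw [mul_add, e1, e2, ← mul_add, div_add_div _ _ ha.ne' hb.ne', hsum, ← mul_div_assoc,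
      ← mul_div_assoc, div_le_div_iff₀ (mul_pos ha hb) hs]
    nlinarith [mul_le_mul_of_nonneg_left key hct]
  rw [Real.cot_eq_cos_div_sin, div_mul_eq_mul_div, le_div_iff₀ hn']
  linarith

lemma chebKernelSum_le_sum_cot {n : ℕ} (hn : 1 ≤ n) (θ : ℝ) :
    chebKernelSum n θ ≤ 2 / n * ∑ k ∈ Finset.range n, Real.cot (chebAngle n k / 2) := by
  have hn' : (0 : ℝ) < n := by positivity
  have hpi := Real.pi_pos
  set t₀ := Real.pi / (2 * n) with ht₀
  have ht₀pos : 0 < t₀ := by positivity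
  have hcont : Continuous (chebKernelSum n) := by
    unfold chebKernelSum
    exact continuous_finsetSum _ fun k _ =>
      ((chebKernel_continuous n).comp (continuous_id.sub continuous_const)).abs
  obtain ⟨y, hy, hθy⟩ :=
    (chebKernelSum_periodic hn).exists_mem_Ico (by positivity) θ (-t₀)
  have hy' : y ∈ closure (Set.Ioo (-t₀) t₀) := by
    rw [closure_Ioo (by linarith)]
    refine ⟨hy.1, hy.2.le.trans (le_of_eq ?_)⟩
    rw [ht₀]; field_simp; ring
  rw [hθy]
  refine le_on_closure (fun x hx => ?_) hcont.continuousOn continuousOn_const hy'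
  rw [chebKernelSum_eq_sum_pairs, Finset.mul_sum]
  exact Finset.sum_le_sum fun k hk =>
    chebKernel_pair_le (Finset.mem_range.mp hk) (abs_lt.mpr hx)

lemma mul_cos_le_sin {x : ℝ} (h0 : 0 ≤ x) (hx : x ≤ Real.pi / 2) :
    x * Real.cos x ≤ Real.sin x := by
  rcases hx.eq_or_lt with rfl | hlt
  · simp
  · have hc : 0 < Real.cos x := Real.cos_pos_of_mem_Ioo ⟨by linarith, hlt⟩
    have h := Real.le_tan h0 hlt
    rwa [Real.tan_eq_sin_div_cos, le_div_iff₀ hc] at h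

lemma mul_cos_le_one_sub_mul_sin {x : ℝ} (h0 : 0 ≤ x) (hx : x ≤ Real.pi / 2) :
    x * Real.cos x ≤ (1 - x ^ 2 / 3) * Real.sin x := by
  have hder (y : ℝ) : HasDerivAt
      (fun y : ℝ => (1 - y ^ 2 / 3) * Real.sin y - y * Real.cos y)
      (y / 3 * (Real.sin y - y * Real.cos y)) y := by
    have h1 : HasDerivAt (fun y : ℝ => 1 - y ^ 2 / 3) (-(2 * y / 3)) y := by
      simpa using (((hasDerivAt_id y).pow 2).div_const 3).const_sub 1
    refine ((h1.mul (Real.hasDerivAt_sin y)).sub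
      ((hasDerivAt_id y).mul (Real.hasDerivAt_cos y))).congr_deriv ?_
    simp only [id]
    ring
  have hmono : MonotoneOn (fun y : ℝ => (1 - y ^ 2 / 3) * Real.sin y - y * Real.cos y)
      (Set.Icc 0 (Real.pi / 2)) := by
    refine monotoneOn_of_hasDerivWithinAt_nonneg (convex_Icc _ _)
      (fun y _ => (hder y).continuousAt.continuousWithinAt)
      (fun y _ => (hder y).hasDerivWithinAt) fun y hy => ?_
    rw [interior_Icc] at hy
    exact mul_nonneg (by linarith [hy.1]) (by linarith [mul_cos_le_sin hy.1.le hy.2.le])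
  have h := hmono ⟨le_rfl, by positivity⟩ ⟨h0, hx⟩ h0
  simp only [Real.sin_zero, mul_zero, zero_mul, sub_zero] at h
  linarith

lemma cot_le_inv_sub {x : ℝ} (h0 : 0 < x) (hx : x ≤ Real.pi / 2) :
    Real.cot x ≤ 1 / x - x / 3 := by
  have hs : 0 < Real.sin x := Real.sin_pos_of_pos_of_lt_pi h0 (by linarith [Real.pi_pos])
  have h := mul_cos_le_one_sub_mul_sin h0.le hx
  rw [Real.cot_eq_cos_div_sin, div_le_iff₀ hs, show 1 / x - x / 3 = (1 - x ^ 2 / 3) / x by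
    field_simp, div_mul_eq_mul_div, le_div_iff₀ h0]
  linarith

lemma sum_inv_odd_le {n : ℕ} (hn : 2 ≤ n) :
    ∑ k ∈ Finset.range n, 1 / (2 * (k : ℝ) + 1) ≤
      Real.log n / 2 + Real.pi / 4 + Real.pi ^ 2 / 48 := by
  induction n, hn using Nat.le_induction with
  | base =>
    have h1 := Real.log_two_gt_d9
    have h2 := Real.pi_gt_d2
    norm_num [Finset.sum_range_succ]
    nlinarith
  | succ n hn ih =>
    have hn' : (0 : ℝ) < n := by positivity
    rw [Finset.sum_range_succ]
    have h := Real.le_log_one_add_of_nonneg (x := 1 / (n : ℝ)) (by positivity)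
    rw [show 1 + 1 / (n : ℝ) = ((n + 1 : ℕ) : ℝ) / n by push_cast; field_simp,
      Real.log_div (by positivity) hn'.ne',
      show 2 * (1 / (n : ℝ)) / (1 / n + 2) = 2 * (1 / (2 * n + 1)) by field_simp; ring] at h
    linarith

lemma sum_cot_le {n : ℕ} (hn : 1 ≤ n) :
    1 / n * ∑ k ∈ Finset.range n, Real.cot (chebAngle n k / 2) ≤
      (2 / Real.pi) * Real.log n + 1 := by
  have hpi := Real.pi_pos
  have hn' : (0 : ℝ) < n := by positivity
  rcases hn.eq_or_lt with rfl | hn2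
  · have : chebAngle 1 0 / 2 = Real.pi / 4 := by unfold chebAngle; push_cast; ring
    simp [this, Real.cot_eq_cos_div_sin]
  · have hsum : ∑ k ∈ Finset.range n, Real.cot (chebAngle n k / 2) ≤
        ∑ k ∈ Finset.range n, (4 * n / Real.pi * (1 / (2 * (k : ℝ) + 1)) -
          Real.pi / (12 * n) * (2 * k + 1)) := by
      refine Finset.sum_le_sum fun k hk => ?_
      have hk' : (k : ℝ) + 1 ≤ n := by exact_mod_cast Finset.mem_range.mp hk
      have hx0 : 0 < chebAngle n k / 2 := by unfold chebAngle; positivity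
      have hx1 : chebAngle n k / 2 ≤ Real.pi / 2 := by
        unfold chebAngle
        gcongr
        rw [div_le_iff₀ (by positivity)]
        nlinarith
      refine (cot_le_inv_sub hx0 hx1).trans (le_of_eq ?_)
      unfold chebAngle
      field_simp
      ring
    have hodd : ∑ k ∈ Finset.range n, (2 * (k : ℝ) + 1) = n ^ 2 := by
      clear hsum hn2 hn hn'
      induction n with
      | zero => simp
      | succ n ih => rw [Finset.sum_range_succ, ih]; push_cast; ring
    rw [Finset.sum_sub_distrib, ← Finset.mul_sum, ← Finset.mul_sum, hodd] at hsum
    have hinv := sum_inv_odd_le hn2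
    calc 1 / n * ∑ k ∈ Finset.range n, Real.cot (chebAngle n k / 2)
        ≤ 1 / n * (4 * n / Real.pi * (Real.log n / 2 + Real.pi / 4 + Real.pi ^ 2 / 48) -
          Real.pi / (12 * n) * n ^ 2) := by
          gcongr
          refine hsum.trans ?_
          gcongr
      _ = (2 / Real.pi) * Real.log n + 1 := by field_simp; ring

/-- Bound on the Lebesgue function of Chebyshev interpolation. -/
lemma sum_abs_chebBasis_le {n : ℕ} (hn : 1 ≤ n) {α β x : ℝ} (hab : α < β)
    (hx : x ∈ Set.Icc α β) :
    ∑ i : Fin n, |chebBasis n α β i x| ≤ (2 / Real.pi) * Real.log n + 1 := by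
  have hd : 0 < β - α := sub_pos.mpr hab
  have hy : (2 * x - (α + β)) / (α - β) = (α + β - 2 * x) / (β - α) := by
    rw [← neg_div_neg_eq]; congr 1 <;> ring
  have hθ : (2 * x - (α + β)) / (α - β) =
      Real.cos (Real.arccos ((2 * x - (α + β)) / (α - β))) := by
    rw [Real.cos_arccos] <;> rw [hy]
    · rw [le_div_iff₀ hd]; linarith [hx.2]
    · rw [div_le_iff₀ hd]; linarith [hx.1]
  have h1 := sum_abs_chebBasis_le_chebKernelSum hn hθ
  have h2 := chebKernelSum_le_sum_cot hn (Real.arccos ((2 * x - (α + β)) / (α - β)))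
  have h3 := sum_cot_le hn
  rw [show (2 : ℝ) / n = 2 * (1 / n) by ring, mul_assoc] at h2
  linarith

/-- The multilinear contraction of an order-`D` tensor against scaled Chebyshev
basis vectors, evaluated at any point of the box `∏_j [α_j, β_j]`, is bounded by
`((2/π)·log(n) + 1)^D` times the Chebyshev norm of the tensor. -/
theorem tensor_cheb_contraction_bound (D n : ℕ) (hD : 1 ≤ D) (hn : 1 ≤ n)
    (α β : Fin D → ℝ) (hab : ∀ j, α j < β j)
    (T : (Fin D → Fin n) → ℝ)
    (ξ : Fin D → ℝ) (hξ : ∀ j, ξ j ∈ Set.Icc (α j) (β j)) :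
    |∑ i : Fin D → Fin n, T i * ∏ j : Fin D, chebBasis n (α j) (β j) (i j) (ξ j)| ≤
      ((2 / Real.pi) * Real.log n + 1) ^ D * (⨆ i : Fin D → Fin n, |T i|) := by
  have hM (i : Fin D → Fin n) : |T i| ≤ ⨆ i : Fin D → Fin n, |T i| :=
    le_ciSup (f := fun i => |T i|) (Set.finite_range _).bddAbove i
  have hM0 : 0 ≤ ⨆ i : Fin D → Fin n, |T i| := Real.iSup_nonneg fun i => abs_nonneg _
  calc |∑ i : Fin D → Fin n, T i * ∏ j : Fin D, chebBasis n (α j) (β j) (i j) (ξ j)|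
      ≤ ∑ i : Fin D → Fin n, |T i * ∏ j : Fin D, chebBasis n (α j) (β j) (i j) (ξ j)| :=
        Finset.abs_sum_le_sum_abs _ _
    _ ≤ ∑ i : Fin D → Fin n, (∏ j : Fin D, |chebBasis n (α j) (β j) (i j) (ξ j)|) *
          ⨆ i : Fin D → Fin n, |T i| := by
        refine Finset.sum_le_sum fun i _ => ?_
        rw [abs_mul, Finset.abs_prod, mul_comm]
        gcongr
        exact hM i
    _ = (∏ j : Fin D, ∑ k : Fin n, |chebBasis n (α j) (β j) k (ξ j)|) *
          ⨆ i : Fin D → Fin n, |T i| := by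
        rw [← Finset.sum_mul, Fintype.prod_sum]
    _ ≤ ((2 / Real.pi) * Real.log n + 1) ^ D * ⨆ i : Fin D → Fin n, |T i| := by
        gcongr
        calc ∏ j : Fin D, ∑ k : Fin n, |chebBasis n (α j) (β j) k (ξ j)|
            ≤ ∏ _j : Fin D, ((2 / Real.pi) * Real.log n + 1) :=
              Finset.prod_le_prod (fun j _ => Finset.sum_nonneg fun k _ => abs_nonneg _)
                fun j _ => sum_abs_chebBasis_le hn (hab j) (hξ j)
          _ = ((2 / Real.pi) * Real.log n + 1) ^ D := by simp
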